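/- Let T : A × A × A → F be a function on a finite set A with values in a field F such that T(x,y,z) ≠ 0 if and only if x = y = z. Then the slice rank of T equals |A|. -/

import Mathlib

/-- A slice: a function of three variables that factors as a function of one variable
times a function of the remaining two. -/
def IsSlice {A F : Type*} [Field F] (T : A → A → A → F) : Prop :=
  (∃ f : A → F, ∃ g : A → A → F, ∀ x y z, T x y z = f x * g y z) ∨
  (∃ f : A → F, ∃ g : A → A → F, ∀ x y z, T x y z = f y * g x z) ∨
  (∃ f : A → F, ∃ g : A → A → F, ∀ x y z, T x y z = f z * g x y)

/-- The slice rank of `T`: the smallest `m` such that `T` is a sum of `m` slices. -/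
noncomputable def sliceRank {A F : Type*} [Field F] (T : A → A → A → F) : ℕ :=
  sInf {m : ℕ | ∃ c : Fin m → (A → A → A → F), (∀ i, IsSlice (c i)) ∧
    ∀ x y z, T x y z = ∑ i, c i x y z}

/-- Every subspace of `A → F` contains a vector whose support has at least as many elements as
the dimension of the subspace. -/
theorem Submodule.exists_finrank_le_card_support {A F : Type*} [Fintype A] [Field F]
    [DecidableEq F] (W : Submodule F (A → F)) :
    ∃ h ∈ W, Module.finrank F W ≤ Fintype.card {a // h a ≠ 0} := by
  obtain ⟨⟨h, hW⟩, hmax⟩ : ∃ h : W, ∀ w : W,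
      Fintype.card {a // w.1 a ≠ 0} ≤ Fintype.card {a // h.1 a ≠ 0} := by
    have hfin : (Set.range fun w : W => Fintype.card {a // w.1 a ≠ 0}).Finite := by
      refine (Set.finite_Iic (Fintype.card A)).subset ?_
      rintro _ ⟨w, rfl⟩
      exact Fintype.card_subtype_le _
    obtain ⟨_, ⟨h, rfl⟩, hh⟩ := hfin.exists_maximal (Set.range_nonempty _)
    exact ⟨h, fun w => (le_total _ _).elim id (hh ⟨w, rfl⟩)⟩
  refine ⟨h, hW, ?_⟩
  let restrict : W →ₗ[F] ({a // h a ≠ 0} → F) :=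
    (LinearMap.funLeft F F Subtype.val).comp W.subtype
  have hinj : Function.Injective restrict := by
    rw [injective_iff_map_eq_zero]
    rintro ⟨w, hw⟩ hw0
    have hvan : ∀ a, h a ≠ 0 → w a = 0 := fun a ha => congrFun hw0 ⟨a, ha⟩
    by_contra hne
    obtain ⟨b, hb⟩ : ∃ b, w b ≠ 0 := by
      by_contra! hall
      exact hne (Subtype.ext (funext hall))
    have hhb : h b = 0 := by
      by_contra hhb
      exact hb (hvan b hhb)
    refine absurd (hmax ⟨h + w, W.add_mem hW hw⟩) (not_le.mpr ?_)
    rw [Fintype.card_subtype, Fintype.card_subtype]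
    refine Finset.card_lt_card (Finset.ssubset_iff_of_subset ?_ |>.mpr ⟨b, by simpa [hhb], by simpa⟩)
    intro a ha
    have ha' : h a ≠ 0 := by simpa using ha
    simpa [hvan a ha'] using ha'
  simpa using LinearMap.finrank_le_finrank_of_injective hinj

theorem Matrix.rank_add_le_add_rank {m n R : Type*} [Fintype n] [Fintype m] [Field R]
    (M N : Matrix m n R) : (M + N).rank ≤ M.rank + N.rank := by
  have hle : (M + N).mulVecLin.range ≤ M.mulVecLin.range ⊔ N.mulVecLin.range := by
    rintro _ ⟨v, rfl⟩
    rw [Matrix.mulVecLin_add]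
    exact Submodule.add_mem_sup ⟨v, rfl⟩ ⟨v, rfl⟩
  exact (Submodule.finrank_mono hle).trans (Submodule.finrank_add_le_finrank_add_finrank _ _)

theorem Matrix.rank_sum_le {ι m n R : Type*} [Fintype n] [Fintype m] [Field R]
    (s : Finset ι) (M : ι → Matrix m n R) : (∑ i ∈ s, M i).rank ≤ ∑ i ∈ s, (M i).rank := by
  classical
  induction s using Finset.induction_on with
  | empty => simp
  | insert i s hi ih =>
    rw [Finset.sum_insert hi, Finset.sum_insert hi]
    exact (Matrix.rank_add_le_add_rank _ _).trans (Nat.add_le_add_left ih _)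

theorem card_le_of_eq_sum_slices {A F : Type*} [Fintype A] [DecidableEq A] [Field F]
    {T : A → A → A → F} (hT : ∀ x y z, T x y z ≠ 0 ↔ (x = y ∧ y = z)) {m : ℕ}
    {c : Fin m → A → A → A → F} (hc : ∀ i, IsSlice (c i))
    (hsum : ∀ x y z, T x y z = ∑ i, c i x y z) : Fintype.card A ≤ m := by
  classical
  let P : Fin m → Prop := fun i => ∃ f : A → F, ∃ g : A → A → F, ∀ x y z, c i x y z = f z * g x y
  choose f g hfg using fun i : {i // P i} => i.2
  let L : (A → F) →ₗ[F] ({i // P i} → F) := Matrix.mulVecLin (Matrix.of f)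
  have hL : Fintype.card A ≤ Module.finrank F L.ker + Fintype.card {i // P i} := by
    have hrn := L.finrank_range_add_finrank_ker
    have hr := L.range.finrank_le
    rw [Module.finrank_fintype_fun_eq_card] at hrn hr
    lia
  obtain ⟨h, hW, hh⟩ := L.ker.exists_finrank_le_card_support
  let M : Fin m → Matrix A A F := fun i => Matrix.of fun x y => ∑ z, c i x y z * h z
  have hdiag : Matrix.diagonal (fun a => T a a a * h a) = ∑ i, M i := by
    ext x y
    have hM : (∑ i, M i) x y = ∑ z, T x y z * h z := by
      simp only [M, Matrix.sum_apply, Matrix.of_apply, hsum, Finset.sum_mul]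
      exact Finset.sum_comm
    rw [hM, Matrix.diagonal_apply]
    have hzero : ∀ z, ¬(x = y ∧ y = z) → T x y z = 0 := fun z hz =>
      not_not.mp (mt (hT x y z).mp hz)
    split_ifs with hxy
    · subst hxy
      rw [Finset.sum_eq_single x (fun z _ hz => by rw [hzero z (by tauto), zero_mul]) (by simp)]
    · exact (Finset.sum_eq_zero fun z _ => by rw [hzero z (by tauto), zero_mul]).symm
  have hrank : Fintype.card {a // h a ≠ 0} = (∑ i, M i).rank := by
    rw [← hdiag, Matrix.rank_diagonal]
    refine Fintype.card_congr (Equiv.subtypeEquivRight fun a => ?_)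
    simp [(hT a a a).mpr ⟨rfl, rfl⟩]
  have hM : ∀ i, (M i).rank ≤ if P i then 0 else 1 := by
    intro i
    split_ifs with hi
    · have hker : ∑ z, f ⟨i, hi⟩ z * h z = 0 := congrFun (LinearMap.mem_ker.mp hW) ⟨i, hi⟩
      have hMi : M i = 0 := by
        ext x y
        simp only [M, Matrix.of_apply, hfg ⟨i, hi⟩, mul_right_comm _ (g _ _ _), ← Finset.sum_mul,
          hker, zero_mul, Matrix.zero_apply]
      simp [hMi]
    · rcases hc i with ⟨u, v, huv⟩ | ⟨u, v, huv⟩ | hP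
      · have hMi : M i = Matrix.vecMulVec u fun y => ∑ z, v y z * h z := by
          ext x y
          simp [M, Matrix.vecMulVec_apply, huv, Finset.mul_sum, mul_assoc]
        exact hMi ▸ Matrix.rank_vecMulVec_le _ _
      · have hMi : M i = Matrix.vecMulVec (fun x => ∑ z, v x z * h z) u := by
          ext x y
          simp only [M, Matrix.of_apply, Matrix.vecMulVec_apply, huv, Finset.sum_mul]
          exact Finset.sum_congr rfl fun z _ => by ring
        exact hMi ▸ Matrix.rank_vecMulVec_le _ _
      · exact absurd hP hi
  have hcount : (∑ i, if P i then 0 else 1) + Fintype.card {i // P i} = m := by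
    rw [Fintype.card_subtype, Finset.card_filter, ← Finset.sum_add_distrib]
    refine (Finset.sum_congr rfl fun i _ => ?_).trans (Fin.sum_const m 1 |>.trans (by simp))
    split_ifs <;> rfl
  have hle := (Matrix.rank_sum_le Finset.univ M).trans (Finset.sum_le_sum fun i _ => hM i)
  lia

theorem exists_eq_sum_card_slices {A F : Type*} [Fintype A] [Field F] (T : A → A → A → F) :
    ∃ c : Fin (Fintype.card A) → (A → A → A → F), (∀ i, IsSlice (c i)) ∧
      ∀ x y z, T x y z = ∑ i, c i x y z := by
  classical
  let e := Fintype.equivFin A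
  refine ⟨fun i x y z => (if x = e.symm i then 1 else 0) * T (e.symm i) y z, fun i =>
    Or.inl ⟨fun x => if x = e.symm i then 1 else 0, T (e.symm i), fun _ _ _ => rfl⟩,
    fun x y z => ?_⟩
  rw [e.symm.sum_comp fun a => (if x = a then 1 else 0) * T a y z]
  simp

/-- Tao's slice rank lemma: if `T : A × A × A → F` is nonzero exactly on the diagonal,
then its slice rank equals `|A|`. -/
theorem sliceRank_diagonal {A F : Type*} [Fintype A] [DecidableEq A] [Field F]
    (T : A → A → A → F) (hT : ∀ x y z, T x y z ≠ 0 ↔ (x = y ∧ y = z)) :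
    sliceRank T = Fintype.card A := by
  refine le_antisymm (Nat.sInf_le (exists_eq_sum_card_slices T)) ?_
  refine le_csInf ⟨_, exists_eq_sum_card_slices T⟩ ?_
  rintro m ⟨c, hc, hsum⟩
  exact card_le_of_eq_sum_slices hT hc hsum
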